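/- Fix a real m > 0 and q ∈ (0,1]. Let p^0 be a probability mass function on ℤ, and define p^n inductively by the q-lazy cooperative motion recursion p^{n+1}_k = p^n_k(1 − q(p^n_k)^m) + (q/2)(p^n_{k+1})^{m+1} + (q/2)(p^n_{k−1})^{m+1}. Then for every x ∈ ℝ, lim_{n→∞} Σ_{k∈ℤ, k ≤ x·n^{1/(m+2)}} p^n_k = (1/B(a,a)) ∫_0^{min(max(1/2 + x/(q^{1/(m+2)} c_m), 0), 1)} y^{1/m}(1−y)^{1/m} dy with a = (m+1)/m; equivalently, if X_n has law p^n, then X_n/n^{1/(m+2)} converges in distribution to c_m q^{1/(m+2)}(B − 1/2) where B is Beta(a,a)-distributed. -/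

import Mathlib

open Filter MeasureTheory

/-- The Beta function `B(a,b) = Γ(a)Γ(b)/Γ(a+b)`. -/
noncomputable def betaFn (a b : ℝ) : ℝ := Real.Gamma a * Real.Gamma b / Real.Gamma (a + b)

/-- `ρ = m/(2(m+2))`. -/
noncomputable def rhoC (m : ℝ) : ℝ := m / (2 * (m + 2))

/-- `D = ρ^{-1/2} B(1/2, (m+1)/m)`. -/
noncomputable def DC (m : ℝ) : ℝ := rhoC m ^ (-(1 / 2) : ℝ) * betaFn (1 / 2) ((m + 1) / m)

/-- `c_m = 2^{(m+1)/(m+2)} (m+1)^{1/(m+2)} / (D^{m/(m+2)} ρ^{1/2})`. -/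
noncomputable def cC (m : ℝ) : ℝ :=
  (2 : ℝ) ^ ((m + 1) / (m + 2)) * (m + 1) ^ (1 / (m + 2)) /
    (DC m ^ (m / (m + 2)) * rhoC m ^ ((1 : ℝ) / 2))

section Concentration

variable {m : ℝ}

lemma exists_rpow_sub_eq (hm : 0 < m) {x y : ℝ} (hxy : x < y) :
    ∃ c, x < c ∧ c < y ∧ y ^ (m + 1) - x ^ (m + 1) = (m + 1) * c ^ m * (y - x) := by
  have hd : ∀ t : ℝ, HasDerivAt (fun t : ℝ => t ^ (m + 1)) ((m + 1) * t ^ m) t := by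
    intro t
    have := Real.hasDerivAt_rpow_const (x := t) (p := m + 1) (Or.inr (by linarith))
    simpa using this
  obtain ⟨c, hc, h⟩ := exists_hasDerivAt_eq_slope (fun t : ℝ => t ^ (m + 1))
    (fun t => (m + 1) * t ^ m) hxy (fun t _ => (hd t).continuousAt.continuousWithinAt)
    (fun t _ => hd t)
  refine ⟨c, hc.1, hc.2, ?_⟩
  rw [h]
  have : y - x ≠ 0 := by linarith
  field_simp

lemma rpow_sub_rpow_lt_two_mul (hm : 0 < m) {x y : ℝ} (hx : 0 ≤ x) (hxy : x < y)
    (h : x + y ≤ 1) : y ^ (m + 1) - x ^ (m + 1) < 2 * (y - x) := by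
  have hy : 0 < y := by linarith
  rcases le_or_gt (2 * x) y with h2 | h2
  · have h1 : y ^ (m + 1) ≤ y := by
      calc y ^ (m + 1) ≤ y ^ (1 : ℝ) :=
            Real.rpow_le_rpow_of_exponent_ge hy (by linarith) (by linarith)
        _ = y := Real.rpow_one y
    rcases hx.eq_or_lt with rfl | hx0
    · rw [Real.zero_rpow (by linarith)]
      linarith
    · have := Real.rpow_pos_of_pos hx0 (m + 1)
      linarith
  · obtain ⟨c, hc1, hc2, hc⟩ := exists_rpow_sub_eq hm hxy
    rw [hc]
    have hcpos : 0 < c := by linarith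
    refine mul_lt_mul_of_pos_right ?_ (by linarith)
    rcases le_or_gt m 1 with hm1 | hm1
    · have : c ^ m < 1 := Real.rpow_lt_one hcpos.le (by linarith) hm
      have := Real.rpow_pos_of_pos hcpos m
      nlinarith
    · have h3 : 1 + m * (1 / 2) ≤ (1 + 1 / 2 : ℝ) ^ m :=
        one_add_mul_self_le_rpow_one_add (by norm_num) hm1.le
      have h4 : c ^ m * (1 + 1 / 2 : ℝ) ^ m ≤ 1 := by
        rw [← Real.mul_rpow hcpos.le (by norm_num)]
        exact Real.rpow_le_one (by positivity) (by linarith) hm.le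
      have := Real.rpow_pos_of_pos hcpos m
      nlinarith

lemma rpow_sub_rpow_le_midpoint (hm : 0 < m) (hm1 : m ≤ 1) {x y : ℝ} (hx : 0 ≤ x) (hxy : x < y) :
    y ^ (m + 1) - x ^ (m + 1) ≤ (m + 1) * ((x + y) / 2) ^ m * (y - x) := by
  set c := (x + y) / 2 with hc
  have hc0 : 0 < c := by rw [hc]; linarith
  have hder : ∀ t : ℝ, HasDerivAt (fun t : ℝ => (m + 1) * c ^ m *
      (t + m * (t ^ 2 / (2 * c) - t)) - t ^ (m + 1))
      ((m + 1) * c ^ m * (1 + m * (t / c - 1)) - (m + 1) * t ^ m) t := by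
    intro t
    have h1 := Real.hasDerivAt_rpow_const (x := t) (p := m + 1) (Or.inr (by linarith))
    have h2 : HasDerivAt (fun t : ℝ => (m + 1) * c ^ m * (t + m * (t ^ 2 / (2 * c) - t)))
        ((m + 1) * c ^ m * (1 + m * (t / c - 1))) t := by
      have h3 := ((hasDerivAt_id t).add ((((hasDerivAt_pow 2 t).div_const (2 * c)).sub
        (hasDerivAt_id t)).const_mul m)).const_mul ((m + 1) * c ^ m)
      refine (h3.congr_deriv ?_).congr_of_eventuallyEq (Eventually.of_forall fun s => ?_)
      · field_simp
        push_cast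
        ring
      · simp
    rw [add_sub_cancel_right] at h1
    exact h2.sub h1
  have hmono : MonotoneOn (fun t : ℝ => (m + 1) * c ^ m *
      (t + m * (t ^ 2 / (2 * c) - t)) - t ^ (m + 1)) (Set.Ici 0) := by
    refine monotoneOn_of_deriv_nonneg (convex_Ici 0)
      (fun t _ => (hder t).continuousAt.continuousWithinAt)
      (fun t _ => (hder t).differentiableAt.differentiableWithinAt) ?_
    intro t ht
    rw [interior_Ici, Set.mem_Ioi] at ht
    rw [(hder t).deriv]
    have h1 : (1 + (t / c - 1)) ^ m ≤ 1 + m * (t / c - 1) :=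
      rpow_one_add_le_one_add_mul_self (by have := div_pos ht hc0; linarith) hm.le hm1
    have h2 : t ^ m = c ^ m * (1 + (t / c - 1)) ^ m := by
      rw [← Real.mul_rpow hc0.le (by have := div_pos ht hc0; linarith)]
      congr 1
      field_simp
      ring
    rw [h2]
    have h3 := Real.rpow_pos_of_pos hc0 m
    have : 0 ≤ (m + 1) * c ^ m * ((1 + m * (t / c - 1)) - (1 + (t / c - 1)) ^ m) := by
      apply mul_nonneg (by positivity); linarith
    linarith
  have h := hmono (Set.mem_Ici.2 hx) (Set.mem_Ici.2 (hx.trans hxy.le)) hxy.le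
  simp only at h
  have h5 : (y + m * (y ^ 2 / (2 * c) - y)) - (x + m * (x ^ 2 / (2 * c) - x)) = y - x := by
    have hxy2 : x = 2 * c - y := by rw [hc]; ring
    rw [hxy2]
    field_simp
    ring
  have h6 : (m + 1) * c ^ m * ((y + m * (y ^ 2 / (2 * c) - y)) - (x + m * (x ^ 2 / (2 * c) - x)))
    = (m + 1) * c ^ m * (y - x) := by rw [h5]
  linarith

lemma rpow_sub_rpow_lt_sub (hm : 0 < m) {x y : ℝ} (hx : 0 ≤ x) (hxy : x < y)
    (h : x + 2 * y ≤ 1) : y ^ (m + 1) - x ^ (m + 1) < y - x := by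
  rcases le_or_gt m 1 with hm1 | hm1
  · refine (rpow_sub_rpow_le_midpoint hm hm1 hx hxy).trans_lt ?_
    have h1 : ((x + y) / 2) ^ m ≤ (1 / 3 : ℝ) ^ m :=
      Real.rpow_le_rpow (by linarith) (by linarith) hm.le
    have h2 : (m + 1) * (1 / 3 : ℝ) ^ m < 1 := by
      have h3 : m + 1 < (3 : ℝ) ^ m := by
        have h4 : m + 1 ≤ Real.exp m := Real.add_one_le_exp m
        have h5 : Real.exp m < (3 : ℝ) ^ m := by
          rw [← Real.exp_one_rpow]
          exact Real.rpow_lt_rpow (Real.exp_pos 1).le (by linarith [Real.exp_one_lt_d9]) hm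
        linarith
      rw [Real.div_rpow zero_le_one (by norm_num), Real.one_rpow, mul_one_div,
        div_lt_one (by positivity)]
      exact h3
    refine mul_lt_of_lt_one_left (by linarith) (lt_of_le_of_lt ?_ h2)
    exact mul_le_mul_of_nonneg_left h1 (by linarith)
  · obtain ⟨c, hc1, hc2, hc⟩ := exists_rpow_sub_eq hm hxy
    rw [hc]
    have hcpos : 0 < c := by linarith
    have h3 : 1 + m * 1 ≤ (1 + 1 : ℝ) ^ m :=
      one_add_mul_self_le_rpow_one_add (by norm_num) hm1.le
    have h4 : c ^ m * (1 + 1 : ℝ) ^ m < 1 := by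
      rw [← Real.mul_rpow hcpos.le (by norm_num)]
      exact Real.rpow_lt_one (by positivity) (by linarith) hm
    have := Real.rpow_pos_of_pos hcpos m
    refine mul_lt_of_lt_one_left (by linarith) (lt_of_le_of_lt ?_ h4)
    rw [mul_comm]
    exact mul_le_mul_of_nonneg_left (by linarith) this.le

lemma cooperative_step_lt_aux (hm : 0 < m) {p a b M : ℝ} (hp : 0 ≤ p) (hb : 0 ≤ b) (hba : b ≤ a)
    (hpM : p ≤ M) (haM : a ≤ M) (hsum : p + a + b ≤ 1) (hM : 1 / 3 < M) :
    p - p ^ (m + 1) + (a ^ (m + 1) + b ^ (m + 1)) / 2 < M := by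
  have hmono : ∀ {x y : ℝ}, 0 ≤ x → x ≤ y → x ^ (m + 1) ≤ y ^ (m + 1) := fun hx hxy =>
    Real.rpow_le_rpow hx hxy (by linarith)
  rcases le_or_gt a p with hap | hap
  · have h1 := hmono (hb.trans hba) hap
    have h2 := hmono hb (hba.trans hap)
    rcases hpM.lt_or_eq with h3 | h3
    · linarith
    · have : b ^ (m + 1) < p ^ (m + 1) := Real.rpow_lt_rpow hb (by linarith) (by linarith)
      linarith
  · have h1 := rpow_sub_rpow_lt_two_mul hm hp hap (by linarith)
    rcases le_or_gt b p with hbp | hbp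
    · have h2 := hmono hb hbp
      linarith
    · have h3 : a ^ (m + 1) - b ^ (m + 1) ≤ 2 * (a - b) := by
        rcases hba.eq_or_lt with rfl | hlt
        · simp
        · exact (rpow_sub_rpow_lt_two_mul hm hb hlt (by linarith)).le
      have h4 := rpow_sub_rpow_lt_sub hm hp hbp (by linarith)
      linarith

lemma cooperative_step_lt (hm : 0 < m) {p a b M : ℝ} (hp : 0 ≤ p) (ha : 0 ≤ a) (hb : 0 ≤ b)
    (hpM : p ≤ M) (haM : a ≤ M) (hbM : b ≤ M) (hsum : p + a + b ≤ 1) (hM : 1 / 3 < M) :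
    p - p ^ (m + 1) + (a ^ (m + 1) + b ^ (m + 1)) / 2 < M := by
  rcases le_total b a with h | h
  · exact cooperative_step_lt_aux hm hp hb h hpM haM hsum hM
  · rw [add_comm (a ^ (m + 1))]
    exact cooperative_step_lt_aux hm hp ha h hpM hbM (by linarith) hM

lemma exists_cooperative_step_gap (hm : 0 < m) {L : ℝ} (hL : 1 / 3 < L) :
    ∃ c > 0, ∀ p a b M : ℝ, 0 ≤ p → 0 ≤ a → 0 ≤ b → p ≤ M → a ≤ M → b ≤ M → p + a + b ≤ 1 →
      L ≤ M → M ≤ 1 → p - p ^ (m + 1) + (a ^ (m + 1) + b ^ (m + 1)) / 2 ≤ M - c := by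
  let K : Set (ℝ × ℝ × ℝ × ℝ) := (Set.Icc 0 1 ×ˢ Set.Icc 0 1 ×ˢ Set.Icc 0 1 ×ˢ Set.Icc L 1) ∩
    {z | z.1 ≤ z.2.2.2 ∧ z.2.1 ≤ z.2.2.2 ∧ z.2.2.1 ≤ z.2.2.2 ∧ z.1 + z.2.1 + z.2.2.1 ≤ 1}
  have hK : IsCompact K := by
    refine (isCompact_Icc.prod (isCompact_Icc.prod (isCompact_Icc.prod isCompact_Icc))).inter_right
      ?_
    simp only [Set.ofPred_and]
    exact (isClosed_le (by fun_prop) (by fun_prop)).inter ((isClosed_le (by fun_prop)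
      (by fun_prop)).inter ((isClosed_le (by fun_prop) (by fun_prop)).inter
      (isClosed_le (by fun_prop) (by fun_prop))))
  let f : ℝ × ℝ × ℝ × ℝ → ℝ := fun z => z.2.2.2 -
    (z.1 - z.1 ^ (m + 1) + (z.2.1 ^ (m + 1) + z.2.2.1 ^ (m + 1)) / 2)
  have hr : Continuous fun t : ℝ => t ^ (m + 1) := Real.continuous_rpow_const (by linarith)
  have hf : Continuous f := by
    have h1 : Continuous fun z : ℝ × ℝ × ℝ × ℝ => z.1 ^ (m + 1) := hr.comp (by fun_prop)
    have h2 : Continuous fun z : ℝ × ℝ × ℝ × ℝ => z.2.1 ^ (m + 1) :=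
      hr.comp (g := fun t : ℝ => t ^ (m + 1)) (f := fun z : ℝ × ℝ × ℝ × ℝ => z.2.1) (by fun_prop)
    have h3 : Continuous fun z : ℝ × ℝ × ℝ × ℝ => z.2.2.1 ^ (m + 1) :=
      hr.comp (g := fun t : ℝ => t ^ (m + 1)) (f := fun z : ℝ × ℝ × ℝ × ℝ => z.2.2.1) (by fun_prop)
    fun_prop
  have hpos : ∀ z ∈ K, 0 < f z := by
    rintro ⟨p, a, b, M⟩ ⟨⟨hp, ha, hb, hM⟩, h1, h2, h3, h4⟩
    have := cooperative_step_lt hm hp.1 ha.1 hb.1 h1 h2 h3 h4 (hL.trans_le hM.1)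
    exact sub_pos.2 this
  obtain ⟨c, hc, h⟩ : ∃ c > 0, ∀ z ∈ K, c ≤ f z := by
    rcases K.eq_empty_or_nonempty with h0 | h0
    · exact ⟨1, one_pos, by simp [h0]⟩
    · obtain ⟨z, hz, hmin⟩ := hK.exists_isMinOn h0 hf.continuousOn
      exact ⟨f z, hpos z hz, fun w hw => hmin hw⟩
  refine ⟨c, hc, fun p a b M hp ha hb hpM haM hbM hs hLM hM1 => ?_⟩
  have := h (p, a, b, M) ⟨⟨⟨hp, by linarith⟩, ⟨ha, by linarith⟩, ⟨hb, by linarith⟩, ⟨hLM, hM1⟩⟩,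
    hpM, haM, hbM, hs⟩
  simp only [f] at this
  linarith

end Concentration

section Scheme

/-- Sum of `f` over the integers at most `k`. -/
noncomputable def lowerSum (f : ℤ → ℝ) (k : ℤ) : ℝ := ∑' j, (Set.Iic k).indicator f j

lemma lowerSum_le_tsum {f : ℤ → ℝ} (hf : ∀ j, 0 ≤ f j) (hs : Summable f) (k : ℤ) :
    lowerSum f k ≤ ∑' j, f j :=
  (hs.indicator _).tsum_le_tsum (fun j => Set.indicator_le_self' (fun i _ => hf i) j) hs

lemma lowerSum_mono {f : ℤ → ℝ} (hf : ∀ j, 0 ≤ f j) (hs : Summable f) :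
    Monotone (lowerSum f) := fun _ _ hkl =>
  (hs.indicator _).tsum_le_tsum (fun j =>
    Set.indicator_le_indicator_of_subset (Set.Iic_subset_Iic.2 hkl) hf j) (hs.indicator _)

lemma lowerSum_add_one {f : ℤ → ℝ} (hs : Summable f) (k : ℤ) :
    lowerSum f (k + 1) = lowerSum f k + f (k + 1) := by
  have h1 : ∀ j, (Set.Iic (k + 1)).indicator f j =
      (Set.Iic k).indicator f j + (({k + 1} : Set ℤ).indicator f j) := by
    intro j
    rcases lt_trichotomy j (k + 1) with h | h | h
    · have h2 : j ≤ k := by omega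
      simp [Set.indicator, h2, h.le, h.ne]
    · subst h
      simp [Set.indicator]
    · have h2 : ¬ j ≤ k := by omega
      simp [Set.indicator, h2, h.not_ge, h.ne']
  unfold lowerSum
  rw [tsum_congr h1, (hs.indicator _).tsum_add (hs.indicator _)]
  congr 1
  rw [tsum_eq_single (k + 1) (fun j hj => by simp [Set.indicator, hj])]
  simp

lemma lowerSum_comp_add_one (f : ℤ → ℝ) (k : ℤ) :
    lowerSum (fun j => f (j + 1)) k = lowerSum f (k + 1) := by
  unfold lowerSum
  rw [← (Equiv.addRight (1 : ℤ)).tsum_eq (fun j => (Set.Iic (k + 1)).indicator f j)]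
  refine tsum_congr fun j => ?_
  simp [Set.indicator]

lemma tendsto_lowerSum_atBot {f : ℤ → ℝ} (hs : Summable f) :
    Tendsto (lowerSum f) atBot (nhds 0) := by
  have : Tendsto (lowerSum f) atBot (nhds (∑' _ : ℤ, (0 : ℝ))) := by
    refine tendsto_tsum_of_dominated_convergence (bound := fun j => |f j|) hs.abs ?_ ?_
    · intro j
      refine tendsto_const_nhds.congr' ?_
      filter_upwards [eventually_lt_atBot j] with k hk
      simp [Set.indicator, hk.not_ge]
    · refine Eventually.of_forall fun k j => ?_
      rw [Set.indicator_apply]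
      split_ifs <;> simp
  simpa using this

lemma lowerSum_add {f g : ℤ → ℝ} (hf : Summable f) (hg : Summable g) (k : ℤ) :
    lowerSum (fun j => f j + g j) k = lowerSum f k + lowerSum g k := by
  unfold lowerSum
  rw [← (hf.indicator _).tsum_add (hg.indicator _)]
  refine tsum_congr fun j => ?_
  simp only [Set.indicator_apply]
  split_ifs <;> simp

lemma lowerSum_const_mul (c : ℝ) (f : ℤ → ℝ) (k : ℤ) :
    lowerSum (fun j => c * f j) k = c * lowerSum f k := by
  unfold lowerSum
  rw [← tsum_mul_left]
  refine tsum_congr fun j => ?_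
  simp only [Set.indicator_apply]
  split_ifs <;> simp

lemma lowerSum_add_laplacian {f r : ℤ → ℝ} (hf : Summable f) (hr : Summable r) (q : ℝ) (k : ℤ) :
    lowerSum (fun k => f k + (-q * r k + (q / 2 * r (k + 1) + q / 2 * r (k - 1)))) k =
      lowerSum f k + q / 2 * (r (k + 1) - r k) := by
  have h1 : Summable fun j => r (j + 1) := (Equiv.addRight (1 : ℤ)).summable_iff.2 hr
  have h2 : Summable fun j => r (j - 1) := (Equiv.subRight (1 : ℤ)).summable_iff.2 hr
  rw [lowerSum_add hf ((hr.mul_left _).add ((h1.mul_left _).add (h2.mul_left _))),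
    lowerSum_add (hr.mul_left _) ((h1.mul_left _).add (h2.mul_left _)),
    lowerSum_add (h1.mul_left _) (h2.mul_left _), lowerSum_const_mul,
    lowerSum_const_mul _ (fun k => r (k + 1)), lowerSum_const_mul _ (fun k => r (k - 1)),
    lowerSum_comp_add_one, lowerSum_add_one hr]
  have h4 : lowerSum (fun j => r (j - 1)) k = lowerSum r (k - 1) := by
    have := lowerSum_comp_add_one (fun j => r (j - 1)) (k - 1)
    simpa using this.symm
  have h5 : lowerSum r k = lowerSum r (k - 1) + r k := by
    have := lowerSum_add_one hr (k - 1)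
    simpa using this
  rw [h4]
  linear_combination (-q / 2) * h5

/-- The sequence of mass functions of a `q`-lazy symmetric cooperative motion. -/
structure IsCooperativeMotion (m q : ℝ) (p : ℕ → ℤ → ℝ) : Prop where
  zero_nonneg : ∀ k : ℤ, 0 ≤ p 0 k
  zero_hasSum : HasSum (p 0) 1
  succ_eq : ∀ (n : ℕ) (k : ℤ), p (n + 1) k = p n k * (1 - q * p n k ^ m) +
    (q / 2) * p n (k + 1) ^ (m + 1) + (q / 2) * p n (k - 1) ^ (m + 1)

namespace IsCooperativeMotion

variable {m q : ℝ} {p : ℕ → ℤ → ℝ}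

lemma mass_le_one {f : ℤ → ℝ} (hf : ∀ j, 0 ≤ f j) (hs : HasSum f 1) (k : ℤ) : f k ≤ 1 := by
  have := sum_le_hasSum {k} (fun i _ => hf i) hs
  simpa using this

lemma summable_rpow (hm : 0 < m) {f : ℤ → ℝ} (hf : ∀ j, 0 ≤ f j) (hs : HasSum f 1) :
    Summable fun j => f j ^ (m + 1) := by
  refine Summable.of_nonneg_of_le (fun j => Real.rpow_nonneg (hf j) _) (fun j => ?_) hs.summable
  calc f j ^ (m + 1) ≤ f j ^ (1 : ℝ) :=
        Real.rpow_le_rpow_of_exponent_ge' (hf j) (mass_le_one hf hs j) zero_le_one (by linarith)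
    _ = f j := Real.rpow_one _

lemma succ_eq_of_nonneg (h : IsCooperativeMotion m q p) (hm : 0 < m) {n : ℕ}
    (hn : ∀ k, 0 ≤ p n k) (k : ℤ) : p (n + 1) k = p n k + (-q * p n k ^ (m + 1) +
      (q / 2 * p n (k + 1) ^ (m + 1) + q / 2 * p n (k - 1) ^ (m + 1))) := by
  rw [h.succ_eq, Real.rpow_add_one' (hn k) (by linarith)]
  ring

lemma nonneg_and_hasSum (h : IsCooperativeMotion m q p) (hm : 0 < m) (hq0 : 0 < q) (hq1 : q ≤ 1)
    (n : ℕ) : (∀ k, 0 ≤ p n k) ∧ HasSum (p n) 1 := by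
  induction n with
  | zero => exact ⟨h.zero_nonneg, h.zero_hasSum⟩
  | succ n ih =>
    obtain ⟨h0, hs⟩ := ih
    have hle := mass_le_one h0 hs
    constructor
    · intro k
      rw [h.succ_eq]
      have h1 : p n k ^ m ≤ 1 := Real.rpow_le_one (h0 k) (hle k) hm.le
      have h2 := Real.rpow_nonneg (h0 k) m
      have h3 := Real.rpow_nonneg (h0 (k + 1)) (m + 1)
      have h4 := Real.rpow_nonneg (h0 (k - 1)) (m + 1)
      have h5 : 0 ≤ p n k * (1 - q * p n k ^ m) := mul_nonneg (h0 k) (by nlinarith)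
      positivity
    · have hr := (summable_rpow hm h0 hs).hasSum
      have h1 := (Equiv.addRight (1 : ℤ)).hasSum_iff.2 hr
      have h2 := (Equiv.subRight (1 : ℤ)).hasSum_iff.2 hr
      have h3 := hs.add ((hr.mul_left (-q)).add ((h1.mul_left (q / 2)).add (h2.mul_left (q / 2))))
      convert h3 using 1
      · funext k
        exact h.succ_eq_of_nonneg hm h0 k
      · ring

lemma add_add_le_one {f : ℤ → ℝ} (hf : ∀ j, 0 ≤ f j) (hs : HasSum f 1) (k : ℤ) :
    f k + f (k + 1) + f (k - 1) ≤ 1 := by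
  have := sum_le_hasSum {k, k + 1, k - 1} (fun i _ => hf i) hs
  rw [Finset.sum_insert (by simp; omega), Finset.sum_insert (by simp; omega),
    Finset.sum_singleton] at this
  linarith

lemma exists_forall_ge_le (h : IsCooperativeMotion m q p) (hm : 0 < m) (hq0 : 0 < q)
    (hq1 : q ≤ 1) {L : ℝ} (hL : 1 / 3 < L) (hL1 : L ≤ 1) : ∃ N, ∀ n ≥ N, ∀ k, p n k ≤ L := by
  obtain ⟨c, hc, hgap⟩ := exists_cooperative_step_gap hm hL
  have key : ∀ n : ℕ, ∀ k, p n k ≤ max L (1 - n * (q * c)) := by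
    intro n
    induction n with
    | zero =>
      intro k
      have := mass_le_one h.zero_nonneg h.zero_hasSum k
      simp [this]
    | succ n ih =>
      intro k
      obtain ⟨h0, hs⟩ := h.nonneg_and_hasSum hm hq0 hq1 n
      set M := max L (1 - n * (q * c)) with hM
      have hM1 : M ≤ 1 := max_le hL1 (by
        have : 0 ≤ (n : ℝ) * (q * c) := by positivity
        linarith)
      have h1 := hgap (p n k) (p n (k + 1)) (p n (k - 1)) M (h0 _) (h0 _) (h0 _) (ih _) (ih _)
        (ih _) (add_add_le_one h0 hs k) (le_max_left _ _) hM1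
      have h2 : p (n + 1) k ≤ M - q * c := by
        rw [h.succ_eq_of_nonneg hm h0]
        have h3 := mul_le_mul_of_nonneg_left h1 hq0.le
        have h4 := mul_le_mul_of_nonneg_left (ih k) (sub_nonneg.2 hq1)
        linarith
      have hqc : 0 < q * c := by positivity
      rcases max_choice L (1 - n * (q * c)) with h3 | h3
      · exact le_max_of_le_left (by rw [hM, h3] at h2; linarith)
      · refine le_max_of_le_right ?_
        rw [hM, h3] at h2
        push_cast
        linarith
  have hqc : 0 < q * c := by positivity
  obtain ⟨N, hN⟩ := exists_nat_ge (1 / (q * c))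
  refine ⟨N, fun n hn k => (key n k).trans (max_le le_rfl ?_)⟩
  have h1 : 1 / (q * c) ≤ n := hN.trans (by exact_mod_cast hn)
  rw [div_le_iff₀ hqc] at h1
  linarith

lemma lowerSum_succ (h : IsCooperativeMotion m q p) (hm : 0 < m) (hq0 : 0 < q) (hq1 : q ≤ 1)
    (n : ℕ) (k : ℤ) : lowerSum (p (n + 1)) k = lowerSum (p n) k +
      q / 2 * (p n (k + 1) ^ (m + 1) - p n k ^ (m + 1)) := by
  obtain ⟨h0, hs⟩ := h.nonneg_and_hasSum hm hq0 hq1 n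
  rw [show p (n + 1) = _ from funext fun k => h.succ_eq_of_nonneg hm h0 k]
  exact lowerSum_add_laplacian hs.summable (summable_rpow hm h0 hs) q k

lemma reflect (h : IsCooperativeMotion m q p) : IsCooperativeMotion m q fun n k => p n (-k) where
  zero_nonneg k := h.zero_nonneg _
  zero_hasSum := (Equiv.neg ℤ).hasSum_iff.2 h.zero_hasSum
  succ_eq n k := by
    rw [h.succ_eq, show -(k + 1) = -k - 1 by ring, show -(k - 1) = -k + 1 by ring]
    ring

end IsCooperativeMotion

lemma rpow_sub_rpow_le_mul {m L a b D : ℝ} (hm : 0 < m) (ha : a ≤ L) (hb : 0 ≤ b)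
    (hD : 0 ≤ D) (h : a - b ≤ D) (ha0 : 0 ≤ a) :
    a ^ (m + 1) - b ^ (m + 1) ≤ (m + 1) * L ^ m * D := by
  have hL : 0 ≤ L ^ m := Real.rpow_nonneg (ha0.trans ha) m
  rcases le_or_gt a b with hab | hab
  · have h1 : a ^ (m + 1) ≤ b ^ (m + 1) := Real.rpow_le_rpow ha0 hab (by linarith)
    have : 0 ≤ (m + 1) * L ^ m * D := by positivity
    linarith
  · obtain ⟨c, hc1, hc2, hc⟩ := exists_rpow_sub_eq hm hab
    rw [hc]
    have h1 : c ^ m ≤ L ^ m := Real.rpow_le_rpow (by linarith) (by linarith) hm.le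
    have h2 : 0 ≤ a - b := by linarith
    gcongr

/-- Comparison principle for one step of the monotone scheme satisfied by the distribution
functions. -/
lemma scheme_comparison {m q L : ℝ} (hm : 0 < m) (hq0 : 0 < q)
    (hqL : q * ((m + 1) * L ^ m) ≤ 1) {F₀ F₁ F₂ G₀ G₁ G₂ C : ℝ}
    (hF1 : 0 ≤ F₁ - F₀) (hF2 : 0 ≤ F₂ - F₁) (hG1 : 0 ≤ G₁ - G₀) (hG2 : 0 ≤ G₂ - G₁)
    (hF2L : F₂ - F₁ ≤ L) (hG1L : G₁ - G₀ ≤ L)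
    (h0 : F₀ ≤ G₀ + C) (h1 : F₁ ≤ G₁ + C) (h2 : F₂ ≤ G₂ + C) :
    F₁ + q / 2 * ((F₂ - F₁) ^ (m + 1) - (F₁ - F₀) ^ (m + 1)) ≤
      G₁ + q / 2 * ((G₂ - G₁) ^ (m + 1) - (G₁ - G₀) ^ (m + 1)) + C := by
  have hD : 0 ≤ C - (F₁ - G₁) := by linarith
  have h3 := rpow_sub_rpow_le_mul hm hF2L hG2 hD (by linarith) hF2
  have h4 := rpow_sub_rpow_le_mul hm hG1L hF1 hD (by linarith) hG1
  have h5 := mul_le_mul_of_nonneg_right hqL hD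
  have h6 := mul_le_mul_of_nonneg_left (add_le_add h3 h4) (half_pos hq0).le
  linarith

lemma IsCooperativeMotion.lowerSum_le_of_supersolution {m q L ε e : ℝ} {p : ℕ → ℤ → ℝ}
    (h : IsCooperativeMotion m q p) (hm : 0 < m) (hq0 : 0 < q) (hq1 : q ≤ 1)
    (hqL : q * ((m + 1) * L ^ m) ≤ 1) {N : ℕ} (hN : ∀ n ≥ N, ∀ k, p n k ≤ L)
    {G : ℕ → ℤ → ℝ} (hG0 : ∀ j k, 0 ≤ G j (k + 1) - G j k) (hGL : ∀ j k, G j (k + 1) - G j k ≤ L)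
    (hG : ∀ j k, G j k + q / 2 * ((G j (k + 1) - G j k) ^ (m + 1) -
      (G j k - G j (k - 1)) ^ (m + 1)) ≤ G (j + 1) k + e)
    (hinit : ∀ k, lowerSum (p N) k ≤ G 0 k + ε) (j : ℕ) (k : ℤ) :
    lowerSum (p (N + j)) k ≤ G j k + (ε + j * e) := by
  induction j generalizing k with
  | zero => simpa using hinit k
  | succ j ih =>
    obtain ⟨h0, hs⟩ := h.nonneg_and_hasSum hm hq0 hq1 (N + j)
    have h1 : p (N + j) (k + 1) = lowerSum (p (N + j)) (k + 1) - lowerSum (p (N + j)) k := by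
      rw [lowerSum_add_one hs.summable]; ring
    have h2 : p (N + j) k = lowerSum (p (N + j)) k - lowerSum (p (N + j)) (k - 1) := by
      have := lowerSum_add_one hs.summable (k - 1)
      rw [sub_add_cancel] at this
      linarith
    rw [← add_assoc, h.lowerSum_succ hm hq0 hq1, h1, h2]
    have h3 := hG0 j (k - 1)
    have h4 := hGL j (k - 1)
    rw [sub_add_cancel] at h3 h4
    have h5 := scheme_comparison hm hq0 hqL (h2 ▸ h0 k) (h1 ▸ h0 (k + 1)) h3 (hG0 j k)
      (h1 ▸ hN (N + j) (by omega) (k + 1)) h4 (ih (k - 1)) (ih k) (ih (k + 1))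
    have h6 := hG j k
    push_cast
    linarith

end Scheme

section Profile

open Topology

/-- A self-similar distribution function `Φ` with density `g` solving the stationary form of
`∂ₜ u = (q / 2) ∂ₓₓ (u ^ (m + 1))`, with support `[-R, R]`. -/
structure IsSelfSimilarProfile (m q R : ℝ) (Φ g : ℝ → ℝ) : Prop where
  radius_pos : 0 < R
  hasDerivAt : ∀ ξ, HasDerivAt Φ (g ξ) ξ
  continuous : Continuous g
  nonneg : ∀ ξ, 0 ≤ g ξ
  eq_zero : ∀ ξ, R ≤ |ξ| → g ξ = 0
  pos : ∀ ξ, |ξ| < R → 0 < g ξ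
  contDiffAt : ∀ ξ, |ξ| < R → ContDiffAt ℝ 1 g ξ
  hasDerivAt_flux : ∀ ξ, HasDerivAt (fun ξ => g ξ ^ (m + 1))
    (-(2 * (1 / (m + 2)) / q) * (ξ * g ξ)) ξ
  eq_one : ∀ ξ, R ≤ ξ → Φ ξ = 1
  neg : ∀ ξ, Φ (-ξ) = 1 - Φ ξ

namespace IsSelfSimilarProfile

variable {m q R : ℝ} {Φ g : ℝ → ℝ}

lemma exists_sub_eq (h : IsSelfSimilarProfile m q R Φ g) {a b : ℝ} (hab : a < b) :
    ∃ c, a < c ∧ c < b ∧ Φ b - Φ a = g c * (b - a) := by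
  obtain ⟨c, hc, h⟩ := exists_hasDerivAt_eq_slope Φ g hab
    (fun t _ => (h.hasDerivAt t).continuousAt.continuousWithinAt) (fun t _ => h.hasDerivAt t)
  refine ⟨c, hc.1, hc.2, ?_⟩
  rw [h]
  have : b - a ≠ 0 := by linarith
  field_simp

lemma monotone (h : IsSelfSimilarProfile m q R Φ g) : Monotone Φ :=
  monotone_of_deriv_nonneg (fun t => (h.hasDerivAt t).differentiableAt)
    fun t => by rw [(h.hasDerivAt t).deriv]; exact h.nonneg t

lemma profile_continuous (h : IsSelfSimilarProfile m q R Φ g) : Continuous Φ :=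
  continuous_iff_continuousAt.2 fun t => (h.hasDerivAt t).continuousAt

lemma eq_zero_of_le (h : IsSelfSimilarProfile m q R Φ g) {ξ : ℝ} (hξ : ξ ≤ -R) : Φ ξ = 0 := by
  have h1 := h.neg (-ξ)
  rw [neg_neg, h.eq_one (-ξ) (by linarith)] at h1
  linarith

lemma profile_nonneg (h : IsSelfSimilarProfile m q R Φ g) (ξ : ℝ) : 0 ≤ Φ ξ := by
  rw [← h.eq_zero_of_le (min_le_right ξ (-R))]
  exact h.monotone (min_le_left _ _)

lemma exists_le (h : IsSelfSimilarProfile m q R Φ g) : ∃ A > 0, ∀ ξ, g ξ ≤ A := by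
  obtain ⟨A, hA⟩ := (isCompact_Icc (a := -R) (b := R)).bddAbove_image h.continuous.continuousOn
  refine ⟨max A 1, by positivity, fun ξ => ?_⟩
  rcases le_or_gt R |ξ| with h1 | h1
  · rw [h.eq_zero ξ h1]
    positivity
  · exact le_max_of_le_left (hA ⟨ξ, abs_le.1 h1.le, rfl⟩)

lemma eventually_flux_near (h : IsSelfSimilarProfile m q R Φ g) (hm : 0 < m)
    {η : ℝ} (hη : 0 < η) (ξ₀ : ℝ) :
    ∀ᶠ z : ℝ × ℝ in 𝓝 (0, ξ₀), 0 < z.1 →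
      |((Φ (z.2 + z.1) - Φ z.2) / z.1) ^ (m + 1) - ((Φ z.2 - Φ (z.2 - z.1)) / z.1) ^ (m + 1) -
        z.1 * (-(2 * (1 / (m + 2)) / q) * (z.2 * g z.2))| ≤ η * z.1 := by
  set ψ : ℝ → ℝ := fun ξ => -(2 * (1 / (m + 2)) / q) * (ξ * g ξ) with hψ
  have hψc : Continuous ψ := by have := h.continuous; fun_prop
  rcases le_or_gt R |ξ₀| with hR | hR
  · have hψ0 : ψ ξ₀ = 0 := by simp [hψ, h.eq_zero ξ₀ hR]
    obtain ⟨δ, hδ, hb⟩ := Metric.continuousAt_iff.1 (hψc.continuousAt (x := ξ₀))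
      (η / 3) (by positivity)
    simp only [hψ0, dist_zero_right, Real.norm_eq_abs, Real.dist_eq] at hb
    have hev : ∀ᶠ z : ℝ × ℝ in 𝓝 (0, ξ₀), z ∈ Metric.ball (0, ξ₀) (δ / 2) :=
      Metric.ball_mem_nhds _ (by positivity)
    filter_upwards [hev] with z hz hz1
    obtain ⟨s, ξ⟩ := z
    simp only [Metric.mem_ball, Prod.dist_eq, Real.dist_eq, max_lt_iff, sub_zero] at hz hz1 ⊢
    obtain ⟨hs, hξ⟩ := hz
    rw [abs_lt] at hs hξ
    obtain ⟨c, hc1, hc2, hc⟩ := h.exists_sub_eq (show ξ < ξ + s by linarith)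
    obtain ⟨d, hd1, hd2, hd⟩ := h.exists_sub_eq (show ξ - s < ξ by linarith)
    rw [hc, hd, add_sub_cancel_left, sub_sub_cancel, mul_div_cancel_right₀ _ hz1.ne',
      mul_div_cancel_right₀ _ hz1.ne']
    have h1 : |g c ^ (m + 1) - g d ^ (m + 1)| ≤ η / 3 * |c - d| := by
      have := (convex_Ioo (ξ - s) (ξ + s)).norm_image_sub_le_of_norm_hasDerivWithin_le
        (f := fun ξ => g ξ ^ (m + 1)) (f' := ψ) (C := η / 3) (x := d) (y := c)
        (fun t _ => (h.hasDerivAt_flux t).hasDerivWithinAt)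
        (fun t ht => (hb (abs_lt.2 ⟨by linarith [ht.1], by linarith [ht.2]⟩)).le)
        ⟨by linarith, by linarith⟩ ⟨by linarith, by linarith⟩
      simpa using this
    have h2 : |ψ ξ| < η / 3 := hb (abs_lt.2 ⟨by linarith, by linarith⟩)
    have h3 : |c - d| ≤ 2 * s := abs_le.2 ⟨by linarith, by linarith⟩
    have h4 : |s * ψ ξ| ≤ η / 3 * s := by
      rw [abs_mul, abs_of_pos hz1, mul_comm]
      exact mul_le_mul_of_nonneg_right h2.le hz1.le
    have h5 := abs_sub (g c ^ (m + 1) - g d ^ (m + 1)) (s * ψ ξ)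
    have h6 : η / 3 * |c - d| ≤ η / 3 * (2 * s) := mul_le_mul_of_nonneg_left h3 (by positivity)
    linarith
  · have hg := h.pos ξ₀ hR
    have hcd := h.contDiffAt ξ₀ hR
    have hdev : ∀ᶠ ξ in 𝓝 ξ₀, HasDerivAt g (deriv g ξ) ξ := by
      filter_upwards [hcd.eventually (by simp)] with ξ hξ
      exact (hξ.differentiableAt one_ne_zero).hasDerivAt
    have hdc : ContinuousAt (deriv g) ξ₀ := by
      have := (hcd.continuousAt_fderiv one_ne_zero).clm_apply (continuousAt_const (y := (1 : ℝ)))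
      simpa using this
    have hval : (m + 1) * g ξ₀ ^ m * deriv g ξ₀ = ψ ξ₀ := by
      have h1 := (hdev.self_of_nhds).rpow_const (p := m + 1) (Or.inl hg.ne')
      have h2 := h1.unique (h.hasDerivAt_flux ξ₀)
      rw [add_sub_cancel_right] at h2
      rw [hψ]
      simp only
      linarith
    have hcont : ContinuousAt (fun w : ℝ × ℝ × ℝ => (m + 1) * g w.1 ^ m * deriv g w.2.1 - ψ w.2.2)
        (ξ₀, ξ₀, ξ₀) := by
      have h1 : ContinuousAt (fun w : ℝ × ℝ × ℝ => g w.1 ^ m) (ξ₀, ξ₀, ξ₀) :=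
        ((h.continuous.comp continuous_fst).rpow_const fun _ => Or.inr hm.le).continuousAt
      have h2 : ContinuousAt (fun w : ℝ × ℝ × ℝ => deriv g w.2.1) (ξ₀, ξ₀, ξ₀) :=
        ContinuousAt.comp (g := deriv g) (f := fun w : ℝ × ℝ × ℝ => w.2.1) hdc (by fun_prop)
      have h3 : ContinuousAt (fun w : ℝ × ℝ × ℝ => ψ w.2.2) (ξ₀, ξ₀, ξ₀) :=
        (hψc.comp (by fun_prop : Continuous fun w : ℝ × ℝ × ℝ => w.2.2)).continuousAt
      exact ((continuousAt_const.mul h1).mul h2).sub h3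
    obtain ⟨δ₁, hδ₁, hb⟩ := Metric.continuousAt_iff.1 hcont η hη
    obtain ⟨δ₂, hδ₂, hd⟩ := Metric.eventually_nhds_iff.1 hdev
    simp only [hval, sub_self, dist_zero_right, Real.norm_eq_abs, Real.dist_eq, Prod.dist_eq]
      at hb hd
    have hev : ∀ᶠ z : ℝ × ℝ in 𝓝 (0, ξ₀), z ∈ Metric.ball (0, ξ₀) (min δ₁ δ₂ / 2) :=
      Metric.ball_mem_nhds _ (by positivity)
    filter_upwards [hev] with z hz hz1
    obtain ⟨s, ξ⟩ := z
    simp only [Metric.mem_ball, Prod.dist_eq, Real.dist_eq, max_lt_iff, sub_zero] at hz hz1 ⊢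
    obtain ⟨hs, hξ⟩ := hz
    have hm1 := min_le_left δ₁ δ₂
    have hm2 := min_le_right δ₁ δ₂
    rw [abs_lt] at hs hξ
    have hder : ∀ t, HasDerivAt (fun t => ((Φ (t + s) - Φ t) / s) ^ (m + 1))
        ((g (t + s) - g t) / s * (m + 1) * ((Φ (t + s) - Φ t) / s) ^ m) t := by
      intro t
      have h1 := ((((h.hasDerivAt (t + s)).comp_add_const t s).sub
        (h.hasDerivAt t)).div_const s).rpow_const (p := m + 1) (Or.inr (by linarith))
      rw [add_sub_cancel_right] at h1
      exact h1
    obtain ⟨a, ha, ha'⟩ := exists_hasDerivAt_eq_slope _ _ (show ξ - s < ξ by linarith)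
      (fun t _ => (hder t).continuousAt.continuousWithinAt) (fun t _ => hder t)
    obtain ⟨b, hb1, hb2⟩ := exists_hasDerivAt_eq_slope g (deriv g) (show a < a + s by linarith)
      (h.continuous.continuousOn)
      (fun t ht => hd (abs_lt.2 ⟨by linarith [ht.1, ha.1], by linarith [ht.2, ha.2]⟩))
    obtain ⟨c, hc1, hc2, hc⟩ := h.exists_sub_eq (show a < a + s by linarith)
    obtain ⟨ha1, ha2⟩ := ha
    obtain ⟨hb3, hb4⟩ := hb1
    rw [hc, add_sub_cancel_left, mul_div_cancel_right₀ _ hz1.ne', sub_sub_cancel,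
      sub_add_cancel, eq_div_iff hz1.ne'] at ha'
    rw [add_sub_cancel_left] at hb2
    rw [← ha', ← hb2, show deriv g b * (m + 1) * g c ^ m * s -
      s * (-(2 * (1 / (m + 2)) / q) * (ξ * g ξ)) = ((m + 1) * g c ^ m * deriv g b - ψ ξ) * s by
        simp only [hψ]; ring, abs_mul, abs_of_pos hz1]
    refine mul_le_mul_of_nonneg_right (hb (x := (c, b, ξ)) ?_).le hz1.le
    simp only [max_lt_iff, abs_lt]
    refine ⟨⟨?_, ?_⟩, ⟨?_, ?_⟩, ?_, ?_⟩ <;> linarith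

lemma exists_forall_flux_near (h : IsSelfSimilarProfile m q R Φ g) (hm : 0 < m)
    {η : ℝ} (hη : 0 < η) : ∃ δ > 0, ∀ s ξ : ℝ, 0 < s → s < δ →
      |((Φ (ξ + s) - Φ ξ) / s) ^ (m + 1) - ((Φ ξ - Φ (ξ - s)) / s) ^ (m + 1) -
        s * (-(2 * (1 / (m + 2)) / q) * (ξ * g ξ))| ≤ η * s := by
  have h1 := (isCompact_Icc (a := -(R + 1)) (b := R + 1)).eventually_forall_of_forall_eventually
    (x₀ := (0 : ℝ)) (P := fun s ξ => 0 < s →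
      |((Φ (ξ + s) - Φ ξ) / s) ^ (m + 1) - ((Φ ξ - Φ (ξ - s)) / s) ^ (m + 1) -
        s * (-(2 * (1 / (m + 2)) / q) * (ξ * g ξ))| ≤ η * s)
          (fun ξ _ => h.eventually_flux_near hm hη ξ)
  obtain ⟨δ, hδ, hb⟩ := Metric.eventually_nhds_iff.1 h1
  refine ⟨min δ 1, by positivity, fun s ξ hs hsδ => ?_⟩
  have hs1 := hsδ.trans_le (min_le_left _ _)
  have hs2 := hsδ.trans_le (min_le_right _ _)
  have hzero : (0 : ℝ) ^ (m + 1) = 0 := Real.zero_rpow (by linarith)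
  rcases le_or_gt ξ (R + 1) with hξ | hξ
  · rcases le_or_gt (-(R + 1)) ξ with hξ' | hξ'
    · exact hb (by simpa [abs_of_pos hs] using hs1) ξ ⟨hξ', hξ⟩ hs
    · rw [h.eq_zero_of_le (by linarith : ξ + s ≤ -R), h.eq_zero_of_le (by linarith : ξ ≤ -R),
        h.eq_zero_of_le (by linarith : ξ - s ≤ -R),
        h.eq_zero ξ (le_abs.2 (Or.inr (by linarith)))]
      simp [hzero]
      positivity
  · rw [h.eq_one (ξ + s) (by linarith), h.eq_one ξ (by linarith), h.eq_one (ξ - s) (by linarith),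
      h.eq_zero ξ (le_abs.2 (Or.inl (by linarith)))]
    simp [hzero]
    positivity

lemma exists_forall_scaling_near (h : IsSelfSimilarProfile m q R Φ g) {α : ℝ} {η : ℝ}
    (hη : 0 < η) : ∃ δ > 0, ∀ s ξ : ℝ, |s - 1| < δ →
      |s * ((ξ * s ^ α) * g (ξ * s ^ α)) - ξ * g ξ| ≤ η := by
  have h1 := (isCompact_Icc (a := -(2 * R)) (b := 2 * R)).eventually_forall_of_forall_eventually
    (x₀ := (1 : ℝ)) (P := fun s ξ => |s * ((ξ * s ^ α) * g (ξ * s ^ α)) - ξ * g ξ| ≤ η) (by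
      intro ξ₀ _
      have hp : ContinuousAt (fun z : ℝ × ℝ => z.1 ^ α) (1, ξ₀) :=
        continuousAt_fst.rpow_const (Or.inl one_ne_zero)
      have hp2 : ContinuousAt (fun z : ℝ × ℝ => z.2 * z.1 ^ α) (1, ξ₀) := continuousAt_snd.mul hp
      have hp3 : ContinuousAt (fun z : ℝ × ℝ => g (z.2 * z.1 ^ α)) (1, ξ₀) :=
        ContinuousAt.comp (g := g) h.continuous.continuousAt hp2
      have hp4 : ContinuousAt (fun z : ℝ × ℝ => g z.2) (1, ξ₀) :=
        ContinuousAt.comp (g := g) h.continuous.continuousAt continuousAt_snd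
      have hc := ((continuousAt_fst.mul (hp2.mul hp3)).sub (continuousAt_snd.mul hp4)).abs
      filter_upwards [hc.eventually (gt_mem_nhds (show _ < η by simpa using hη))] with z hz
      exact hz.le)
  have h2 : ∀ᶠ s in 𝓝 (1 : ℝ), 1 / 2 < s ^ α :=
    ((continuousAt_id (x := (1 : ℝ))).rpow_const (p := α) (Or.inl one_ne_zero)).eventually
      (lt_mem_nhds (by norm_num))
  obtain ⟨δ, hδ, hb⟩ := Metric.eventually_nhds_iff.1 (h1.and h2)
  refine ⟨δ, hδ, fun s ξ hs => ?_⟩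
  obtain ⟨hb1, hb2⟩ := hb hs
  rcases le_or_gt |ξ| (2 * R) with hξ | hξ
  · exact hb1 ξ (abs_le.1 hξ)
  · have hR := h.radius_pos
    rw [h.eq_zero ξ (by linarith), h.eq_zero (ξ * s ^ α) (by
      rw [abs_mul, abs_of_pos (by linarith : 0 < s ^ α)]
      nlinarith)]
    simpa using hη.le

lemma sub_le_of_time_step (h : IsSelfSimilarProfile m q R Φ g) (hm : 0 < m) {η : ℝ}
    (hη : 0 < η) : ∃ T > 0, ∀ t ≥ T, ∀ x : ℝ,
      Φ (x * t ^ (-(1 / (m + 2)))) - 1 / (m + 2) *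
        (x * t ^ (-(1 / (m + 2))) * g (x * t ^ (-(1 / (m + 2))))) * t⁻¹ ≤
      Φ (x * (t + 1) ^ (-(1 / (m + 2)))) + η * t⁻¹ := by
  set α : ℝ := 1 / (m + 2) with hα
  have hα0 : 0 < α := by positivity
  have hα1 : α ≤ 1 := by rw [hα, div_le_one (by linarith)]; linarith
  obtain ⟨δ, hδ, hb⟩ := h.exists_forall_scaling_near (α := α) hη
  refine ⟨1 / δ + 1, by positivity, fun t ht x => ?_⟩
  have hδ' : 0 < 1 / δ := by positivity
  have ht0 : 0 < t := by linarith
  have hder : ∀ τ > 0, HasDerivAt (fun τ => Φ (x * τ ^ (-α)))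
      (g (x * τ ^ (-α)) * (x * (-α * τ ^ (-α - 1)))) τ := fun τ hτ =>
    (h.hasDerivAt _).comp τ ((Real.hasDerivAt_rpow_const (Or.inl hτ.ne')).const_mul x)
  obtain ⟨τ, ⟨hτ1, hτ2⟩, hτ⟩ := exists_hasDerivAt_eq_slope _ _ (show t < t + 1 by linarith)
    (fun s hs => (hder s (by linarith [hs.1])).continuousAt.continuousWithinAt)
    (fun s hs => hder s (by linarith [hs.1]))
  have hτ0 : 0 < τ := by linarith
  rw [add_sub_cancel_left, div_one] at hτ
  have hs : |t / τ - 1| < δ := by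
    rw [div_sub_one hτ0.ne', abs_div, abs_of_pos hτ0, div_lt_iff₀ hτ0, abs_lt]
    have h1 : 1 < τ * δ := by
      rw [← div_lt_iff₀ hδ]; linarith
    constructor <;> linarith
  have h1 := hb (t / τ) (x * t ^ (-α)) hs
  have h2 : x * t ^ (-α) * (t / τ) ^ α = x * τ ^ (-α) := by
    rw [Real.div_rpow ht0.le hτ0.le, Real.rpow_neg ht0.le, Real.rpow_neg hτ0.le]
    have := (Real.rpow_pos_of_pos ht0 α).ne'
    field_simp
  rw [h2] at h1
  have h3 : g (x * τ ^ (-α)) * (x * (-α * τ ^ (-α - 1))) =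
      -α * (t / τ * (x * τ ^ (-α) * g (x * τ ^ (-α)))) * t⁻¹ := by
    rw [Real.rpow_sub_one hτ0.ne']
    field_simp
  rw [h3] at hτ
  have h4 := mul_le_mul_of_nonneg_left (mul_le_mul_of_nonneg_right (abs_le.1 h1).2
    (inv_pos.2 ht0).le) hα0.le
  have h5 : α * (η * t⁻¹) ≤ 1 * (η * t⁻¹) := mul_le_mul_of_nonneg_right hα1 (by positivity)
  linarith

lemma supersolution (h : IsSelfSimilarProfile m q R Φ g) (hm : 0 < m) (hq : 0 < q) {η : ℝ}
    (hη : 0 < η) : ∃ T > 0, ∀ t ≥ T, ∀ x : ℝ,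
      Φ (x * t ^ (-(1 / (m + 2)))) + q / 2 *
        ((Φ ((x + 1) * t ^ (-(1 / (m + 2)))) - Φ (x * t ^ (-(1 / (m + 2))))) ^ (m + 1) -
        (Φ (x * t ^ (-(1 / (m + 2)))) - Φ ((x - 1) * t ^ (-(1 / (m + 2))))) ^ (m + 1)) ≤
      Φ (x * (t + 1) ^ (-(1 / (m + 2)))) + η * t⁻¹ := by
  obtain ⟨T₁, hT₁, h1⟩ := h.sub_le_of_time_step hm (half_pos hη)
  obtain ⟨δ, hδ, h2⟩ := h.exists_forall_flux_near hm (show 0 < η / q by positivity)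
  have h3 : Tendsto (fun t : ℝ => t ^ (-(1 / (m + 2)))) atTop (𝓝 0) :=
    tendsto_rpow_neg_atTop (by positivity)
  obtain ⟨T₂, hT₂⟩ := eventually_atTop.1 (h3.eventually (gt_mem_nhds hδ))
  refine ⟨max T₁ T₂, by positivity, fun t ht x => ?_⟩
  have ht1 := (le_max_left _ _).trans ht
  have ht2 := (le_max_right _ _).trans ht
  have ht0 : 0 < t := by linarith
  have h4 := h1 t ht1 x
  have hspos : 0 < t ^ (-(1 / (m + 2))) := Real.rpow_pos_of_pos ht0 _
  have h5 := h2 (t ^ (-(1 / (m + 2)))) (x * t ^ (-(1 / (m + 2)))) hspos (hT₂ t ht2)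
  have hst : (t ^ (-(1 / (m + 2)))) ^ (m + 1) * t ^ (-(1 / (m + 2))) = t⁻¹ := by
    rw [← Real.rpow_add_one hspos.ne', ← Real.rpow_mul ht0.le, ← Real.rpow_neg_one]
    congr 1
    field_simp
    ring
  set s := t ^ (-(1 / (m + 2))) with hs
  have e1 : (x + 1) * s = x * s + s := by ring
  have e2 : (x - 1) * s = x * s - s := by ring
  have hm1 := h.monotone (show x * s ≤ x * s + s by linarith)
  have hm2 := h.monotone (show x * s - s ≤ x * s by linarith)
  rw [e1, e2]
  rw [Real.div_rpow (by linarith) hspos.le, Real.div_rpow (by linarith) hspos.le] at h5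
  have hsm : 0 < s ^ (m + 1) := Real.rpow_pos_of_pos hspos _
  have h6 := mul_le_mul_of_nonneg_left (abs_le.1 h5).2 hsm.le
  have e3 : ∀ A B D : ℝ, s ^ (m + 1) * (A / s ^ (m + 1) - B / s ^ (m + 1) - s * D) =
      A - B - s ^ (m + 1) * s * D := by
    intro A B D
    field_simp
  rw [e3, hst] at h6
  have h7 := mul_le_mul_of_nonneg_left h6 (half_pos hq).le
  have e4 : q / 2 * (s ^ (m + 1) * (η / q * s)) = η / 2 * t⁻¹ := by
    rw [← hst]
    field_simp
  have e5 : q / 2 * (t⁻¹ * (-(2 * (1 / (m + 2)) / q) * (x * s * g (x * s)))) =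
      -(1 / (m + 2) * (x * s * g (x * s)) * t⁻¹) := by
    field_simp
  rw [e4, mul_sub, e5] at h7
  linarith

end IsSelfSimilarProfile

end Profile

section Limit

open Topology

lemma IsCooperativeMotion.eventually_lowerSum_lt {m q R : ℝ} {p : ℕ → ℤ → ℝ} {Φ g : ℝ → ℝ}
    (h : IsCooperativeMotion m q p) (hΦ : IsSelfSimilarProfile m q R Φ g) (hm : 0 < m)
    (hq0 : 0 < q) (hq1 : q ≤ 1) {x b : ℝ} (hb : Φ x < b) :
    ∀ᶠ n : ℕ in atTop, lowerSum (p n) ⌊x * (n : ℝ) ^ (1 / (m + 2))⌋ < b := by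
  set α : ℝ := 1 / (m + 2) with hα
  have hα0 : 0 < α := by positivity
  set ε : ℝ := (b - Φ x) / 4 with hε
  have hε0 : 0 < ε := by rw [hε]; linarith
  obtain ⟨δ, hδ0, hδ⟩ : ∃ δ > 0, Φ ((x + R * δ ^ α) * (1 + δ) ^ (-α)) < Φ x + ε := by
    have h1 : ContinuousAt (fun δ : ℝ => Φ ((x + R * δ ^ α) * (1 + δ) ^ (-α))) 0 := by
      refine ContinuousAt.comp (g := Φ) hΦ.profile_continuous.continuousAt ?_
      refine ContinuousAt.mul (continuousAt_const.add (continuousAt_const.mul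
        (continuousAt_id.rpow_const (Or.inr hα0.le)))) ?_
      exact (continuousAt_const.add continuousAt_id).rpow_const (Or.inl (by simp))
    have h2 : ∀ᶠ δ in 𝓝[>] (0 : ℝ), Φ ((x + R * δ ^ α) * (1 + δ) ^ (-α)) < Φ x + ε := by
      refine (h1.eventually (gt_mem_nhds ?_)).filter_mono nhdsWithin_le_nhds
      simp [Real.zero_rpow hα0.ne', hε0]
    obtain ⟨δ, hδ1, hδ2⟩ := (h2.and self_mem_nhdsWithin).exists
    exact ⟨δ, hδ2, hδ1⟩
  obtain ⟨T₁, hT₁, hsuper⟩ := hΦ.supersolution hm hq0 (show 0 < ε * δ by positivity)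
  rw [← hα] at hsuper
  set L : ℝ := Real.exp (-1) with hL
  have hL0 : 0 < L := Real.exp_pos _
  have hL13 : 1 / 3 < L := by
    rw [hL, Real.exp_neg, one_div]
    exact inv_strictAnti₀ (Real.exp_pos 1) (by linarith [Real.exp_one_lt_d9])
  have hL1 : L ≤ 1 := Real.exp_le_one_iff.2 (by norm_num)
  have hqL : q * ((m + 1) * L ^ m) ≤ 1 := by
    have h1 : (m + 1) * L ^ m ≤ 1 := by
      rw [hL, ← Real.exp_mul, neg_one_mul, Real.exp_neg, ← div_eq_mul_inv,
        div_le_one (Real.exp_pos m)]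
      exact Real.add_one_le_exp m
    exact mul_le_one₀ hq1 (by positivity) h1
  obtain ⟨N₀, hN₀⟩ := h.exists_forall_ge_le hm hq0 hq1 hL13 hL1
  obtain ⟨A, hA, hgA⟩ := hΦ.exists_le
  obtain ⟨T₂, hT₂⟩ := eventually_atTop.1 ((tendsto_rpow_neg_atTop hα0).eventually
    (gt_mem_nhds (show 0 < L / A by positivity)))
  obtain ⟨h0, hs⟩ := h.nonneg_and_hasSum hm hq0 hq1 N₀
  obtain ⟨K, hK⟩ := eventually_atBot.1 ((tendsto_lowerSum_atBot hs.summable).eventually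
    (gt_mem_nhds hε0))
  have hlim : Tendsto (fun n : ℕ => Φ ((x * (n : ℝ) ^ α - K + R * (δ * n) ^ α) *
      (δ * n + (n - N₀)) ^ (-α))) atTop (𝓝 (Φ ((x + R * δ ^ α) * (1 + δ) ^ (-α)))) := by
    refine (hΦ.profile_continuous.tendsto _).comp ?_
    have h1 : Tendsto (fun n : ℕ => (x - K * (n : ℝ) ^ (-α) + R * δ ^ α) *
        (1 + δ - N₀ / n) ^ (-α)) atTop (𝓝 ((x - K * 0 + R * δ ^ α) * (1 + δ - 0) ^ (-α))) := by
      have h2 : Tendsto (fun n : ℕ => (n : ℝ) ^ (-α)) atTop (𝓝 0) :=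
        (tendsto_rpow_neg_atTop hα0).comp tendsto_natCast_atTop_atTop
      refine ((tendsto_const_nhds.sub (h2.const_mul _)).add_const _).mul ?_
      refine (tendsto_const_nhds.sub (tendsto_const_div_atTop_nhds_zero_nat _)).rpow_const ?_
      left
      linarith
    rw [mul_zero, sub_zero, sub_zero] at h1
    refine h1.congr' ?_
    filter_upwards [eventually_gt_atTop N₀] with n hn
    have hn' : (N₀ : ℝ) < n := by exact_mod_cast hn
    have hn0 : (0 : ℝ) < n := lt_of_le_of_lt (Nat.cast_nonneg _) hn'
    have e1 : δ * n + (n - N₀) = n * (1 + δ - N₀ / n) := by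
      field_simp
      ring
    have hN : (N₀ : ℝ) / n ≤ 1 := (div_le_one hn0).2 hn'.le
    rw [e1, Real.mul_rpow hn0.le (by linarith), Real.mul_rpow hδ0.le hn0.le, Real.rpow_neg hn0.le]
    have := (Real.rpow_pos_of_pos hn0 α).ne'
    field_simp
  filter_upwards [hlim.eventually (gt_mem_nhds hδ), eventually_gt_atTop N₀,
    tendsto_natCast_atTop_atTop.eventually (eventually_ge_atTop (max T₁ T₂ / δ))] with n hn1 hn2 hn3
  have hn' : (N₀ : ℝ) < n := by exact_mod_cast hn2
  have hn0 : (0 : ℝ) < n := lt_of_le_of_lt (Nat.cast_nonneg _) hn'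
  set T : ℝ := δ * n with hT
  have hT0 : 0 < T := by positivity
  have hTmax : max T₁ T₂ ≤ T := by
    rw [hT, mul_comm]
    exact (div_le_iff₀ hδ0).1 hn3
  have hTα : 0 < T ^ α := Real.rpow_pos_of_pos hT0 α
  have hjT : ∀ j : ℕ, T ≤ T + j := fun j => by simp
  have hmain := h.lowerSum_le_of_supersolution hm hq0 hq1 hqL hN₀ (ε := ε) (e := ε * δ * T⁻¹)
    (G := fun j k => Φ (((k : ℝ) - K + R * T ^ α) * (T + j) ^ (-α))) ?_ ?_ ?_ ?_ (n - N₀)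
    ⌊x * (n : ℝ) ^ α⌋
  · have e1 : N₀ + (n - N₀) = n := by omega
    have e2 : ((n - N₀ : ℕ) : ℝ) = n - N₀ := by
      rw [Nat.cast_sub hn2.le]
    rw [e1, e2] at hmain
    have h1 : Φ (((⌊x * (n : ℝ) ^ α⌋ : ℝ) - K + R * T ^ α) * (T + (n - N₀)) ^ (-α)) ≤
        Φ ((x * (n : ℝ) ^ α - K + R * T ^ α) * (T + (n - N₀)) ^ (-α)) := by
      refine hΦ.monotone (mul_le_mul_of_nonneg_right ?_ (Real.rpow_nonneg (by linarith) _))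
      linarith [Int.floor_le (x * (n : ℝ) ^ α)]
    have h2 : ((n : ℝ) - N₀) * (ε * δ * T⁻¹) ≤ ε := by
      have e3 : ε = n * (ε * δ * T⁻¹) := by
        rw [hT]
        field_simp
      conv_rhs => rw [e3]
      refine mul_le_mul_of_nonneg_right ?_ (by positivity)
      linarith [Nat.cast_nonneg (α := ℝ) N₀]
    linarith
  · intro j k
    refine sub_nonneg.2 (hΦ.monotone (mul_le_mul_of_nonneg_right ?_ (Real.rpow_nonneg ?_ _)))
    · push_cast
      linarith
    · linarith [hjT j]
  · intro j k
    have hTj := hjT j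
    have h1 := hT₂ (T + j) (((le_max_right _ _).trans hTmax).trans hTj)
    have h2 : 0 < (T + j) ^ (-α) := Real.rpow_pos_of_pos (by linarith) _
    obtain ⟨c, -, -, hc⟩ := hΦ.exists_sub_eq (a := ((k : ℝ) - K + R * T ^ α) * (T + j) ^ (-α))
      (b := (((k + 1 : ℤ) : ℝ) - K + R * T ^ α) * (T + j) ^ (-α)) (by
        push_cast
        refine mul_lt_mul_of_pos_right ?_ h2
        linarith)
    rw [hc]
    have e1 : (((k + 1 : ℤ) : ℝ) - K + R * T ^ α) * (T + j) ^ (-α) -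
        ((k : ℝ) - K + R * T ^ α) * (T + j) ^ (-α) = (T + j) ^ (-α) := by
      push_cast
      ring
    rw [e1]
    calc g c * (T + j) ^ (-α) ≤ A * (L / A) :=
          mul_le_mul (hgA c) h1.le h2.le hA.le
      _ = L := by field_simp
  · intro j k
    have hTj := hjT j
    have h1 := hsuper (T + j) (((le_max_left _ _).trans hTmax).trans hTj)
      ((k : ℝ) - K + R * T ^ α)
    have e1 : (((k + 1 : ℤ) : ℝ) - K + R * T ^ α) = (k : ℝ) - K + R * T ^ α + 1 := by
      push_cast
      ring
    have e2 : (((k - 1 : ℤ) : ℝ) - K + R * T ^ α) = (k : ℝ) - K + R * T ^ α - 1 := by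
      push_cast
      ring
    have e3 : T + ((j + 1 : ℕ) : ℝ) = T + j + 1 := by
      push_cast
      ring
    rw [e1, e2, e3]
    refine h1.trans ?_
    have h2 : (T + j)⁻¹ ≤ T⁻¹ := inv_anti₀ hT0 hTj
    have h3 := mul_le_mul_of_nonneg_left h2 (show 0 ≤ ε * δ by positivity)
    linarith
  · intro k
    simp only [Nat.cast_zero, add_zero]
    rcases le_or_gt k K with hk | hk
    · have h1 := hK k hk
      have h2 := hΦ.profile_nonneg (((k : ℝ) - K + R * T ^ α) * T ^ (-α))
      linarith
    · have hk' : (K : ℝ) < k := by exact_mod_cast hk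
      have h1 : R ≤ ((k : ℝ) - K + R * T ^ α) * T ^ (-α) := by
        rw [Real.rpow_neg hT0.le, ← div_eq_mul_inv, le_div_iff₀ hTα]
        linarith
      rw [hΦ.eq_one _ h1]
      have h2 := lowerSum_le_tsum h0 hs.summable k
      rw [hs.tsum_eq] at h2
      linarith

lemma lowerSum_add_lowerSum_neg {f : ℤ → ℝ} (hs : HasSum f 1) (k : ℤ) :
    lowerSum f k + lowerSum (fun j => f (-j)) (-k - 1) = 1 := by
  have h1 : lowerSum (fun j => f (-j)) (-k - 1) = ∑' j, (Set.Ioi k).indicator f j := by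
    unfold lowerSum
    rw [← (Equiv.neg ℤ).tsum_eq (fun j => (Set.Ioi k).indicator f j)]
    refine tsum_congr fun j => ?_
    simp only [Set.indicator_apply, Set.mem_Iic, Set.mem_Ioi, Equiv.neg_apply]
    congr 1
    rw [eq_iff_iff]
    omega
  rw [h1, lowerSum, ← (hs.summable.indicator _).tsum_add (hs.summable.indicator _), ← hs.tsum_eq]
  refine tsum_congr fun j => ?_
  rcases le_or_gt j k with h | h
  · simp [Set.indicator, h, h.not_gt]
  · simp [Set.indicator, h, h.not_ge]

theorem IsCooperativeMotion.tendsto_lowerSum {m q R : ℝ} {p : ℕ → ℤ → ℝ} {Φ g : ℝ → ℝ}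
    (h : IsCooperativeMotion m q p) (hΦ : IsSelfSimilarProfile m q R Φ g) (hm : 0 < m)
    (hq0 : 0 < q) (hq1 : q ≤ 1) (x : ℝ) :
    Tendsto (fun n : ℕ => lowerSum (p n) ⌊x * (n : ℝ) ^ (1 / (m + 2))⌋) atTop (𝓝 (Φ x)) := by
  refine tendsto_order.2 ⟨fun b hb => ?_, fun b hb => h.eventually_lowerSum_lt hΦ hm hq0 hq1 hb⟩
  have h1 := h.reflect.eventually_lowerSum_lt hΦ hm hq0 hq1 (x := -x) (b := 1 - b)
    (by rw [hΦ.neg]; linarith)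
  filter_upwards [h1] with n hn
  obtain ⟨h0, hs⟩ := h.nonneg_and_hasSum hm hq0 hq1 n
  have h2 := lowerSum_add_lowerSum_neg hs ⌊x * (n : ℝ) ^ (1 / (m + 2))⌋
  have h3 : lowerSum (fun j => p n (-j)) (-⌊x * (n : ℝ) ^ (1 / (m + 2))⌋ - 1) ≤
      lowerSum (fun j => p n (-j)) ⌊-x * (n : ℝ) ^ (1 / (m + 2))⌋ := by
    refine lowerSum_mono (fun j => h0 _) ((Equiv.neg ℤ).summable_iff.2 hs.summable) ?_
    rw [Int.le_floor]
    push_cast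
    linarith [Int.lt_floor_add_one (x * (n : ℝ) ^ (1 / (m + 2)))]
  linarith

end Limit

section Barenblatt

open Topology

lemma betaFn_pos {a b : ℝ} (ha : 0 < a) (hb : 0 < b) : 0 < betaFn a b :=
  ProbabilityTheory.beta_pos ha hb

lemma betaFn_self {a : ℝ} (ha : 0 < a) :
    betaFn a a = 2 ^ (1 - 2 * a) * betaFn (1 / 2) a := by
  have h1 := Real.Gamma_mul_Gamma_add_half a
  have h2 := Real.Gamma_pos_of_pos (show 0 < a + 1 / 2 by linarith)
  have h3 := Real.Gamma_pos_of_pos (show 0 < 2 * a by linarith)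
  have h4 := Real.Gamma_one_half_eq
  unfold betaFn
  rw [h4, ← two_mul, add_comm (1 / 2) a]
  generalize Real.Gamma (a + 1 / 2) = G at h1 h2 ⊢
  field_simp
  linear_combination h1

lemma integral_rpow_mul_rpow_one_sub {a : ℝ} (ha : 0 < a) :
    ∫ y in (0 : ℝ)..1, y ^ (a - 1) * (1 - y) ^ (a - 1) = betaFn a a := by
  have h := ProbabilityTheory.beta_eq_betaIntegralReal a a ha ha
  change betaFn a a = _ at h
  have h2 : Complex.betaIntegral a a =
      ((∫ y in (0 : ℝ)..1, y ^ (a - 1) * (1 - y) ^ (a - 1) : ℝ) : ℂ) := by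
    rw [← intervalIntegral.integral_ofReal, Complex.betaIntegral]
    refine intervalIntegral.integral_congr fun y hy => ?_
    rw [Set.uIcc_of_le zero_le_one] at hy
    simp only [Complex.ofReal_mul]
    rw [Complex.ofReal_cpow hy.1, Complex.ofReal_cpow (by linarith [hy.2])]
    push_cast
    rfl
  rw [h, h2, Complex.ofReal_re]

lemma cC_pos {m : ℝ} (hm : 0 < m) : 0 < cC m := by
  have h1 : 0 < rhoC m := by unfold rhoC; positivity
  have h2 : 0 < betaFn (1 / 2) ((m + 1) / m) := betaFn_pos (by norm_num) (by positivity)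
  have h3 : 0 < DC m := by unfold DC; positivity
  unfold cC
  positivity

lemma cC_rpow_mul_betaFn_rpow {m : ℝ} (hm : 0 < m) :
    cC m ^ (m + 2) * betaFn ((m + 1) / m) ((m + 1) / m) ^ m = (m + 1) * (m + 2) / m := by
  have hρ : 0 < rhoC m := by unfold rhoC; positivity
  have hb : 0 < betaFn (1 / 2) ((m + 1) / m) := betaFn_pos (by norm_num) (by positivity)
  have hD : 0 < DC m := by unfold DC; positivity
  have hDm : DC m ^ m * rhoC m ^ ((m + 2) / 2) =
      betaFn (1 / 2) ((m + 1) / m) ^ m * rhoC m := by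
    unfold DC
    rw [Real.mul_rpow (by positivity) hb.le, ← Real.rpow_mul hρ.le]
    calc _ = betaFn (1 / 2) ((m + 1) / m) ^ m *
          (rhoC m ^ (-(1 / 2) * m) * rhoC m ^ ((m + 2) / 2)) := by ring
      _ = _ := by
          rw [← Real.rpow_add hρ, show -(1 / 2) * m + (m + 2) / 2 = 1 by ring, Real.rpow_one]
  have hc : cC m ^ (m + 2) = 2 ^ (m + 1) * (m + 1) /
      (betaFn (1 / 2) ((m + 1) / m) ^ m * rhoC m) := by
    rw [← hDm]
    unfold cC
    rw [Real.div_rpow (by positivity) (by positivity),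
      Real.mul_rpow (by positivity) (by positivity), Real.mul_rpow (by positivity) (by positivity),
      ← Real.rpow_mul (by norm_num),
      ← Real.rpow_mul (by positivity), ← Real.rpow_mul hD.le, ← Real.rpow_mul hρ.le,
      div_mul_cancel₀ _ (by positivity), div_mul_cancel₀ _ (by positivity),
      div_mul_cancel₀ _ (by positivity), Real.rpow_one]
    congr 3
    ring
  have hB : betaFn ((m + 1) / m) ((m + 1) / m) ^ m =
      2 ^ (-(m + 2)) * betaFn (1 / 2) ((m + 1) / m) ^ m := by
    rw [betaFn_self (by positivity), Real.mul_rpow (by positivity) hb.le,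
      ← Real.rpow_mul (by norm_num)]
    congr 2
    field_simp
    ring
  have h2 : (2 : ℝ) ^ (m + 1) * 2 ^ (-(m + 2)) = 1 / 2 := by
    rw [← Real.rpow_add (by norm_num), show m + 1 + -(m + 2) = -1 by ring, Real.rpow_neg_one]
    norm_num
  have hbm : betaFn (1 / 2) ((m + 1) / m) ^ m ≠ 0 := (Real.rpow_pos_of_pos hb m).ne'
  calc _ = (2 : ℝ) ^ (m + 1) * 2 ^ (-(m + 2)) * (m + 1) / rhoC m := by
        rw [hc, hB]
        field_simp
    _ = _ := by
        rw [h2, rhoC]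
        field_simp

/-- The unnormalised Beta density `(y (1 - y)) ^ (1 / m)`, extended by zero outside `[0, 1]`. -/
noncomputable def bump (m y : ℝ) : ℝ := (max (y * (1 - y)) 0) ^ (1 / m)

lemma continuous_bump {m : ℝ} (hm : 0 < m) : Continuous (bump m) := by
  unfold bump
  exact Continuous.rpow_const (by fun_prop) fun y => Or.inr (by positivity)

lemma bump_nonneg (m y : ℝ) : 0 ≤ bump m y :=
  Real.rpow_nonneg (le_max_right _ _) _

lemma bump_eq_zero {m y : ℝ} (hm : 0 < m) (hy : y * (1 - y) ≤ 0) : bump m y = 0 := by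
  rw [bump, max_eq_right hy, Real.zero_rpow (by positivity)]

lemma bump_pos {m y : ℝ} (hy : 0 < y * (1 - y)) : 0 < bump m y :=
  Real.rpow_pos_of_pos (lt_max_of_lt_left hy) _

lemma bump_one_sub (m y : ℝ) : bump m (1 - y) = bump m y := by
  rw [bump, bump, sub_sub_cancel, mul_comm]

lemma bump_eq {m y : ℝ} (h0 : 0 ≤ y) (h1 : y ≤ 1) :
    bump m y = y ^ (1 / m) * (1 - y) ^ (1 / m) := by
  have : 0 ≤ 1 - y := by linarith
  rw [bump, max_eq_left (by positivity), Real.mul_rpow h0 this]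

lemma contDiffAt_bump {m y : ℝ} (hy : 0 < y * (1 - y)) : ContDiffAt ℝ 1 (bump m) y := by
  have h1 : ContDiffAt ℝ 1 (fun y : ℝ => (y * (1 - y)) ^ (1 / m)) y :=
    ContDiffAt.rpow_const_of_ne (by fun_prop) hy.ne'
  refine h1.congr_of_eventuallyEq ?_
  have hc : ContinuousAt (fun y : ℝ => y * (1 - y)) y := by fun_prop
  filter_upwards [hc.eventually (lt_mem_nhds hy)] with z hz
  rw [bump, max_eq_left hz.le]

lemma hasDerivAt_max_zero_rpow {r : ℝ} (hr : 1 < r) (t : ℝ) :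
    HasDerivAt (fun t : ℝ => (max t 0) ^ r) (r * (max t 0) ^ (r - 1)) t := by
  rcases lt_trichotomy t 0 with ht | rfl | ht
  · rw [max_eq_right ht.le, Real.zero_rpow (by linarith), mul_zero]
    refine (hasDerivAt_const t (0 : ℝ)).congr_of_eventuallyEq ?_
    filter_upwards [gt_mem_nhds ht] with s hs
    rw [max_eq_right hs.le, Real.zero_rpow (by linarith)]
  · have h0 : HasDerivAt (fun t : ℝ => t ^ r) (r * 0 ^ (r - 1)) 0 :=
      Real.hasDerivAt_rpow_const (Or.inr hr.le)
    rw [Real.zero_rpow (by linarith), mul_zero] at h0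
    rw [max_self, Real.zero_rpow (by linarith), mul_zero]
    rw [hasDerivAt_iff_isLittleO] at h0 ⊢
    refine Asymptotics.IsBigO.trans_isLittleO (Asymptotics.isBigO_of_le _ fun s => ?_) h0
    simp only [max_self, sub_zero, smul_zero, Real.zero_rpow (show r ≠ 0 by linarith)]
    rcases le_or_gt s 0 with hs | hs
    · rw [max_eq_right hs, Real.zero_rpow (by linarith), norm_zero]
      exact norm_nonneg _
    · rw [max_eq_left hs.le]
  · rw [max_eq_left ht.le]
    refine (Real.hasDerivAt_rpow_const (Or.inr hr.le)).congr_of_eventuallyEq ?_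
    filter_upwards [lt_mem_nhds ht] with s hs
    rw [max_eq_left hs.le]

lemma hasDerivAt_bump_rpow {m : ℝ} (hm : 0 < m) (y : ℝ) :
    HasDerivAt (fun y => bump m y ^ (m + 1)) ((m + 1) / m * bump m y * (1 - 2 * y)) y := by
  have h1 : HasDerivAt (fun y : ℝ => y * (1 - y)) (1 - 2 * y) y := by
    convert! (hasDerivAt_id y).mul ((hasDerivAt_id y).const_sub 1) using 1
    simp only [id]
    ring
  have hr : 1 < (m + 1) / m := by rw [lt_div_iff₀ hm]; linarith
  have h2 := (hasDerivAt_max_zero_rpow hr (y * (1 - y))).comp y h1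
  have h3 : (m + 1) / m - 1 = 1 / m := by field_simp; ring
  rw [h3] at h2
  convert! h2 using 1
  funext z
  simp only [bump, Function.comp]
  rw [← Real.rpow_mul (le_max_right _ _)]
  congr 1
  ring

lemma integral_bump {m : ℝ} (hm : 0 < m) :
    ∫ y in (0 : ℝ)..1, bump m y = betaFn ((m + 1) / m) ((m + 1) / m) := by
  rw [← integral_rpow_mul_rpow_one_sub (show 0 < (m + 1) / m by positivity)]
  refine intervalIntegral.integral_congr fun y hy => ?_
  rw [Set.uIcc_of_le zero_le_one] at hy
  simp only [bump_eq hy.1 hy.2]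
  rw [show (m + 1) / m - 1 = 1 / m by field_simp; ring]

lemma integral_bump_eq_of_one_le {m v : ℝ} (hm : 0 < m) (hv : 1 ≤ v) :
    ∫ y in (0 : ℝ)..v, bump m y = ∫ y in (0 : ℝ)..1, bump m y := by
  have hi := fun a b => (continuous_bump hm).intervalIntegrable (μ := volume) a b
  rw [← intervalIntegral.integral_add_adjacent_intervals (hi 0 1) (hi 1 v), add_eq_left]
  rw [← intervalIntegral.integral_zero (a := 1) (b := v) (μ := volume)]
  refine intervalIntegral.integral_congr fun y hy => ?_
  rw [Set.uIcc_of_le hv] at hy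
  exact bump_eq_zero hm (mul_nonpos_of_nonneg_of_nonpos (by linarith [hy.1]) (by linarith [hy.1]))

lemma integral_bump_one_sub {m : ℝ} (hm : 0 < m) (v : ℝ) :
    ∫ y in (0 : ℝ)..(1 - v), bump m y =
      betaFn ((m + 1) / m) ((m + 1) / m) - ∫ y in (0 : ℝ)..v, bump m y := by
  have hi := fun a b => (continuous_bump hm).intervalIntegrable (μ := volume) a b
  have h1 := intervalIntegral.integral_comp_sub_left (a := 0) (b := v) (bump m) 1
  simp only [bump_one_sub, sub_zero] at h1
  rw [h1, ← integral_bump hm,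
    ← intervalIntegral.integral_add_adjacent_intervals (hi 0 (1 - v)) (hi (1 - v) 1)]
  ring

lemma integral_bump_eq_clamp {m : ℝ} (hm : 0 < m) (v : ℝ) :
    ∫ y in (0 : ℝ)..v, bump m y =
      ∫ y in (0 : ℝ)..(min (max v 0) 1), y ^ (1 / m) * (1 - y) ^ (1 / m) := by
  have h0 : 0 ≤ min (max v 0) 1 := le_min (le_max_right _ _) zero_le_one
  have h1 : ∫ y in (0 : ℝ)..v, bump m y = ∫ y in (0 : ℝ)..(min (max v 0) 1), bump m y := by
    rcases le_total 1 v with hv | hv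
    · rw [max_eq_left (by linarith), min_eq_right hv, integral_bump_eq_of_one_le hm hv]
    rcases le_total 0 v with hv0 | hv0
    · rw [max_eq_left hv0, min_eq_left hv]
    · rw [max_eq_right hv0, min_eq_left zero_le_one, intervalIntegral.integral_same]
      have h2 := integral_bump_one_sub hm (1 - v)
      rw [sub_sub_cancel, integral_bump_eq_of_one_le hm (show 1 ≤ 1 - v by linarith),
        integral_bump hm, sub_self] at h2
      exact h2
  rw [h1]
  refine intervalIntegral.integral_congr fun y hy => ?_
  rw [Set.uIcc_of_le h0] at hy
  exact bump_eq hy.1 (hy.2.trans (min_le_right _ _))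

lemma isSelfSimilarProfile_beta {m q c : ℝ} (hm : 0 < m) (hq : 0 < q) (hc : 0 < c)
    (hcB : c ^ (m + 2) * betaFn ((m + 1) / m) ((m + 1) / m) ^ m = q * ((m + 1) * (m + 2) / m)) :
    IsSelfSimilarProfile m q (c / 2)
      (fun ξ => 1 / betaFn ((m + 1) / m) ((m + 1) / m) *
        ∫ y in (0 : ℝ)..(1 / 2 + ξ / c), bump m y)
      (fun ξ => 1 / (c * betaFn ((m + 1) / m) ((m + 1) / m)) * bump m (1 / 2 + ξ / c)) := by
  have hB : 0 < betaFn ((m + 1) / m) ((m + 1) / m) := betaFn_pos (by positivity) (by positivity)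
  have hBi := integral_bump hm
  have hBn := integral_bump_one_sub hm
  set B := betaFn ((m + 1) / m) ((m + 1) / m)
  have hlin (ξ : ℝ) : HasDerivAt (fun ξ : ℝ => 1 / 2 + ξ / c) (1 / c) ξ :=
    ((hasDerivAt_id ξ).div_const c).const_add (1 / 2)
  have hprod (ξ : ℝ) : (1 / 2 + ξ / c) * (1 - (1 / 2 + ξ / c)) = ((c / 2) ^ 2 - ξ ^ 2) / c ^ 2 := by
    field_simp
    ring
  have hcont := continuous_bump hm
  have hpos (ξ : ℝ) (hξ : |ξ| < c / 2) : 0 < (1 / 2 + ξ / c) * (1 - (1 / 2 + ξ / c)) := by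
    rw [hprod]
    have := sq_lt_sq' (by linarith [neg_abs_le ξ, abs_nonneg ξ]) hξ
    rw [sq_abs] at this
    exact div_pos (by linarith) (by positivity)
  refine ⟨by positivity, fun ξ => ?_, ?_, fun ξ => ?_, fun ξ hξ => ?_, fun ξ hξ => ?_,
    fun ξ hξ => ?_, fun ξ => ?_, fun ξ hξ => ?_, fun ξ => ?_⟩
  · have h1 : HasDerivAt (fun v => ∫ y in (0 : ℝ)..v, bump m y) (bump m (1 / 2 + ξ / c))
        (1 / 2 + ξ / c) :=
      intervalIntegral.integral_hasDerivAt_right (hcont.intervalIntegrable _ _)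
        (hcont.stronglyMeasurableAtFilter _ _) hcont.continuousAt
    have h2 := (h1.comp ξ (hlin ξ)).const_mul (1 / B)
    convert! h2 using 1
    field_simp
  · exact continuous_const.mul (hcont.comp (by fun_prop))
  · exact mul_nonneg (by positivity) (bump_nonneg _ _)
  · have : (c / 2) ^ 2 ≤ |ξ| ^ 2 := by gcongr
    rw [sq_abs] at this
    rw [bump_eq_zero hm (by
      rw [hprod]
      exact div_nonpos_of_nonpos_of_nonneg (by linarith) (by positivity)), mul_zero]
  · exact mul_pos (by positivity) (bump_pos (hpos ξ hξ))
  · exact contDiffAt_const.mul ((contDiffAt_bump (hpos ξ hξ)).comp ξ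
      (contDiffAt_const.add (contDiffAt_id.div_const c)))
  · have h1 := ((hasDerivAt_bump_rpow hm (1 / 2 + ξ / c)).comp ξ (hlin ξ)).const_mul
      ((1 / (c * B)) ^ (m + 1))
    have hsplit : (c * B) ^ (m + 1) * c ^ 2 = q * ((m + 1) * (m + 2) / m) * (c * B) := by
      have e1 : c ^ (m + 2) = c ^ (m + 1) * c := by
        rw [← Real.rpow_add_one hc.ne']
        congr 1
        ring
      rw [← hcB, Real.mul_rpow hc.le hB.le, Real.rpow_add_one hB.ne', e1]
      ring
    have hcoef : (1 / (c * B)) ^ (m + 1) = c ^ 2 / (q * ((m + 1) * (m + 2) / m) * (c * B)) := by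
      rw [Real.div_rpow zero_le_one (by positivity), Real.one_rpow, ← hsplit]
      have : (c * B) ^ (m + 1) ≠ 0 := (Real.rpow_pos_of_pos (by positivity) _).ne'
      field_simp
    convert! h1 using 1
    · funext z
      rw [Real.mul_rpow (by positivity) (bump_nonneg _ _)]
      rfl
    · rw [hcoef]
      field_simp
      ring
  · have : 1 ≤ 1 / 2 + ξ / c := by
      have : 1 / 2 ≤ ξ / c := by rw [le_div_iff₀ hc]; linarith
      linarith
    rw [integral_bump_eq_of_one_le hm this, hBi, one_div_mul_cancel hB.ne']
  · rw [show 1 / 2 + -ξ / c = 1 - (1 / 2 + ξ / c) by ring, hBn]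
    field_simp

end Barenblatt

theorem statement16
    (m q : ℝ) (hm : 0 < m) (hq0 : 0 < q) (hq1 : q ≤ 1)
    (p : ℕ → ℤ → ℝ)
    (h0nonneg : ∀ k : ℤ, 0 ≤ p 0 k)
    (h0sum : HasSum (p 0) 1)
    (hrec : ∀ (n : ℕ) (k : ℤ),
      p (n + 1) k =
        p n k * (1 - q * p n k ^ m) + (q / 2) * p n (k + 1) ^ (m + 1)
          + (q / 2) * p n (k - 1) ^ (m + 1))
    (x : ℝ) :
    Tendsto
      (fun n : ℕ =>
        ∑' k : ℤ, if (k : ℝ) ≤ x * (n : ℝ) ^ (1 / (m + 2)) then p n k else 0)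
      atTop
      (nhds ((1 / betaFn ((m + 1) / m) ((m + 1) / m)) *
        ∫ y in (0 : ℝ)..(min (max (1 / 2 + x / (q ^ (1 / (m + 2)) * cC m)) 0) 1),
          y ^ (1 / m) * (1 - y) ^ (1 / m))) := by
  have hq := Real.rpow_pos_of_pos hq0 (1 / (m + 2))
  have hc : 0 < q ^ (1 / (m + 2)) * cC m := mul_pos hq (cC_pos hm)
  have hcB : (q ^ (1 / (m + 2)) * cC m) ^ (m + 2) * betaFn ((m + 1) / m) ((m + 1) / m) ^ m =
      q * ((m + 1) * (m + 2) / m) := by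
    rw [Real.mul_rpow hq.le (cC_pos hm).le, ← Real.rpow_mul hq0.le,
      div_mul_cancel₀ _ (by positivity), Real.rpow_one, mul_assoc, cC_rpow_mul_betaFn_rpow hm]
  have hmotion : IsCooperativeMotion m q p := ⟨h0nonneg, h0sum, hrec⟩
  have hlim := hmotion.tendsto_lowerSum (isSelfSimilarProfile_beta hm hq0 hc hcB) hm hq0 hq1 x
  simp only [integral_bump_eq_clamp hm] at hlim
  refine hlim.congr fun n => tsum_congr fun k => ?_
  simp only [Set.indicator, Set.mem_Iic, Int.le_floor]
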